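/- arXiv:1412.8498 — 4 statements merged into one kernel-verified Lean document; each statement's English description precedes it below -/
import Mathlib

section
/- Let n ≥ 1 and let d : Fin n → Fin n → ℤ be an arbitrary n×n array of integers. Then there exist integers N_1,…,N_n and h_1,…,h_n such that d(i,j) ≤ N_j − h_i for all i,j, and such that ∑_{j=1}^n N_j − ∑_{i=1}^n h_i = max_{σ ∈ S_n} ∑_{i=1}^n d(i, σ(i)). In other words, an optimal majorant of the order array always exists. -/
/-- `N` and `h` form a majorant of the integer array `d`. -/
def IsMajorant {ι : Type*} (d : ι → ι → ℤ) (N h : ι → ℤ) : Prop :=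
  ∀ i j, d i j ≤ N j - h i

namespace IsMajorant

variable {ι : Type*} {d : ι → ι → ℤ} {N h : ι → ℤ}

theorem sum_perm_le [Fintype ι] (hd : IsMajorant d N h) (σ : Equiv.Perm ι) :
    ∑ i, d i (σ i) ≤ ∑ j, N j - ∑ i, h i := by
  rw [← Equiv.sum_comp σ N, ← Finset.sum_sub_distrib]
  exact Finset.sum_le_sum fun i _ => hd i (σ i)

/-- Shifting `h` up on a set of rows, and `N` up on the columns where these rows are tight,
preserves majorants. -/
theorem shift [DecidableEq ι] (hd : IsMajorant d N h) {S T : Finset ι}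
    (hT : ∀ i ∈ S, ∀ j, d i j = N j - h i → j ∈ T) :
    IsMajorant d (fun j => N j + if j ∈ T then 1 else 0)
      (fun i => h i + if i ∈ S then 1 else 0) := by
  intro i j
  have hij := hd i j
  have hTij := fun hi => hT i hi j
  dsimp only
  split_ifs <;> grind

end IsMajorant

theorem exists_isMajorant {ι : Type*} [Fintype ι] (d : ι → ι → ℤ) :
    ∃ N h, IsMajorant d N h := by
  refine ⟨fun j => ∑ i, |d i j|, 0, fun i j => ?_⟩
  simpa using (le_abs_self _).trans
    (Finset.single_le_sum (f := fun i => |d i j|) (fun _ _ => abs_nonneg _) (Finset.mem_univ i))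

theorem exists_isMajorant_forall_sum_le {ι : Type*} [Fintype ι] (d : ι → ι → ℤ) :
    ∃ N h, IsMajorant d N h ∧
      ∀ N' h', IsMajorant d N' h' → ∑ j, N j - ∑ i, h i ≤ ∑ j, N' j - ∑ i, h' i := by
  obtain ⟨N₀, h₀, hd₀⟩ := exists_isMajorant d
  obtain ⟨_, ⟨N, h, hd, rfl⟩, hmin⟩ := Int.exists_least_of_bdd
    (P := fun z => ∃ N h, IsMajorant d N h ∧ ∑ j, N j - ∑ i, h i = z)
    ⟨∑ i, d i i, fun _ ⟨_, _, hd, hz⟩ => hz ▸ hd.sum_perm_le (Equiv.refl ι)⟩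
    ⟨_, N₀, h₀, hd₀, rfl⟩
  exact ⟨N, h, hd, fun N' h' hd' => hmin _ ⟨N', h', hd', rfl⟩⟩

/-- A majorant of least total is tight along some permutation, by Hall's theorem. -/
theorem IsMajorant.exists_perm_tight {ι : Type*} [Fintype ι] [DecidableEq ι] {d : ι → ι → ℤ}
    {N h : ι → ℤ} (hd : IsMajorant d N h)
    (hmin : ∀ N' h', IsMajorant d N' h' → ∑ j, N j - ∑ i, h i ≤ ∑ j, N' j - ∑ i, h' i) :
    ∃ σ : Equiv.Perm ι, ∀ i, d i (σ i) = N (σ i) - h i := by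
  let t : ι → Finset ι := fun i => {j | d i j = N j - h i}
  obtain ⟨f, hf, hft⟩ := (Finset.all_card_le_biUnion_card_iff_exists_injective t).1 fun S => by
    have hle := hmin _ _ (hd.shift (S := S) (T := S.biUnion t) fun i hi j hij =>
      Finset.mem_biUnion.2 ⟨i, hi, by simpa [t] using hij⟩)
    simp only [Finset.sum_add_distrib, Finset.sum_ite_mem, Finset.univ_inter, Finset.sum_const,
      nsmul_eq_mul, mul_one] at hle
    omega
  exact ⟨Equiv.ofBijective f (Finite.injective_iff_bijective.1 hf),
    fun i => by simpa [t] using hft i⟩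

/-- Existence of an optimal majorant: for any `n × n` array of integers `d`,
there exist integers `N_j`, `h_i` with `d i j ≤ N j - h i` for all `i j`, and
`∑ N - ∑ h` equal to the total order `tord d = max_{σ} ∑ i, d i (σ i)`. -/
theorem exists_optimal_majorant (n : ℕ) (hn : 1 ≤ n) (d : Fin n → Fin n → ℤ) :
    ∃ N h : Fin n → ℤ,
      (∀ i j, d i j ≤ N j - h i) ∧
      (∑ j, N j) - (∑ i, h i) =
        Finset.univ.sup' Finset.univ_nonempty
          (fun σ : Equiv.Perm (Fin n) => ∑ i, d i (σ i)) := by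
  obtain ⟨N, h, hd, hmin⟩ := exists_isMajorant_forall_sum_le d
  obtain ⟨σ, hσ⟩ := hd.exists_perm_tight hmin
  refine ⟨N, h, hd, le_antisymm ?_ (Finset.sup'_le _ _ fun τ _ => hd.sum_perm_le τ)⟩
  calc ∑ j, N j - ∑ i, h i = ∑ i, d i (σ i) := by
        simp only [hσ, Finset.sum_sub_distrib, Equiv.sum_comp σ N]
    _ ≤ _ := Finset.le_sup' (fun τ : Equiv.Perm (Fin n) => ∑ i, d i (τ i)) (Finset.mem_univ σ)
end

section
/- Let R be a commutative ring, n ≥ 1, let A_1,…,A_n ∈ R^n and B_1,…,B_n ∈ R^n be row vectors, and let c_1,…,c_n ∈ R satisfy c_1 A_1 + c_2 A_2 + ⋯ + c_n A_n = 0. Let M be the n×n matrix whose first row is c_1 B_1 + c_2 B_2 + ⋯ + c_n B_n and whose k-th row is A_k for k = 2,…,n. Then c_1 divides det M in R. -/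
namespace Matrix

variable {n R : Type*} [Fintype n] [DecidableEq n] [CommRing R]

/-- If the rows of `A` satisfy the linear relation `c`, then `c i` divides `c j * det M` for every
matrix `M` obtained from `A` by replacing its `i`-th row. -/
theorem dvd_mul_det_updateRow_of_sum_smul_eq_zero (A : Matrix n n R) (c : n → R)
    (h : ∑ k, c k • A k = 0) (i j : n) (b : n → R) :
    c i ∣ c j * (A.updateRow i b).det := by
  have key : ∑ k, c k • A.updateRow i b k = c i • (b - A i) := by
    rw [← sub_zero (∑ k, _), ← h, ← Finset.sum_sub_distrib, Finset.sum_eq_single i]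
    · rw [updateRow_self, smul_sub]
    · intro k _ hk
      rw [updateRow_ne hk, sub_self]
    · simp
  rw [← smul_eq_mul, ← det_updateRow_sum, key, det_updateRow_smul]
  exact dvd_mul_right _ _

theorem det_updateRow_sum_smul {ι : Type*} (A : Matrix n n R) (i : n) (s : Finset ι) (c : ι → R)
    (B : ι → n → R) :
    (A.updateRow i (∑ j ∈ s, c j • B j)).det = ∑ j ∈ s, c j * (A.updateRow i (B j)).det := by
  classical
  simp only [← det_updateRow_smul]
  exact (detRowAlternating : (n → R) [⋀^n]→ₗ[R] R).map_update_sum s i (fun j => c j • B j) A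

end Matrix

/-- If `∑ k, c k • A k = 0` and `M` has first row `∑ k, c k • B k` and rows
`A k` for `k ≠ 0`, then `c 0` divides `det M`. -/
theorem c_one_dvd_det {R : Type*} [CommRing R] (n : ℕ) (hn : 1 ≤ n)
    (A B : Fin n → Fin n → R) (c : Fin n → R)
    (hrel : ∑ k, c k • A k = 0) :
    c ⟨0, hn⟩ ∣
      (Matrix.of fun k =>
        if k = (⟨0, hn⟩ : Fin n) then ∑ j, c j • B j else A k).det := by
  have hM : (Matrix.of fun k => if k = (⟨0, hn⟩ : Fin n) then ∑ j, c j • B j else A k) =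
      (Matrix.of A).updateRow ⟨0, hn⟩ (∑ j, c j • B j) := by
    ext k l
    by_cases hk : k = ⟨0, hn⟩ <;> simp [Matrix.updateRow_apply, hk]
  rw [hM, Matrix.det_updateRow_sum_smul]
  exact Finset.dvd_sum fun j _ =>
    Matrix.dvd_mul_det_updateRow_of_sum_smul_eq_zero (Matrix.of A) c hrel _ j (B j)
end

section
/- Let K be a field, n ≥ 1, and let M be an n×n matrix with entries in K[X] such that det M ≠ 0. Let N_1,…,N_n and h_1,…,h_n be integers such that for all i,j: deg(M_{ij}) ≤ N_j − h_i (in particular M_{ij} = 0 whenever N_j − h_i < 0). Define the characteristic matrix Ā with entries in K[λ] by Ā_{ij} = a_{ij} λ^{N_j − h_i}, where a_{ij} is the coefficient of X^{N_j − h_i} in M_{ij} when N_j − h_i ≥ 0, and Ā_{ij} = 0 when N_j − h_i < 0. If ∑_{j=1}^n N_j − ∑_{i=1}^n h_i > deg(det M), then det Ā = 0. -/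
open Polynomial

/-- If `natDegree (f i) ≤ d i` for all `i ∈ s`, then the coefficient of `∏ i ∈ s, f i` in degree
`∑ i ∈ s, d i` is the product of the coefficients of the `f i` in degree `d i`. -/
theorem Polynomial.coeff_prod_sum_of_natDegree_le {R ι : Type*} [CommSemiring R]
    (s : Finset ι) (f : ι → R[X]) (d : ι → ℕ) (hd : ∀ i ∈ s, (f i).natDegree ≤ d i) :
    (∏ i ∈ s, f i).coeff (∑ i ∈ s, d i) = ∏ i ∈ s, (f i).coeff (d i) := by
  classical
  induction s using Finset.induction_on with
  | empty => simp
  | insert a s ha ih =>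
    have hs : ∀ i ∈ s, (f i).natDegree ≤ d i := fun i hi => hd i (Finset.mem_insert_of_mem hi)
    rw [Finset.prod_insert ha, Finset.sum_insert ha, Finset.prod_insert ha,
      coeff_mul_add_eq_of_natDegree_le (hd a (Finset.mem_insert_self a s))
        ((natDegree_prod_le s f).trans (Finset.sum_le_sum hs)), ih hs]

/-- For a non-optimal majorant `(N, h)` of a polynomial matrix `M` with
`det M ≠ 0` (i.e. `∑ N - ∑ h > deg (det M)`), the determinant of the
characteristic matrix `Ā i j = (coeff of X^(N j - h i) in M i j) · λ^(N j - h i)`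
(taken to be `0` when `N j - h i < 0`) vanishes. -/
theorem det_char_matrix_eq_zero_of_nonoptimal {K : Type*} [Field K]
    (n : ℕ) (hn : 1 ≤ n) (M : Matrix (Fin n) (Fin n) K[X])
    (hdet : M.det ≠ 0) (N h : Fin n → ℤ)
    (hmaj : ∀ i j, ((M i j).degree.map (Nat.cast : ℕ → ℤ)) ≤
      ((N j - h i : ℤ) : WithBot ℤ))
    (hlt : ((M.det.natDegree : ℤ)) < (∑ j, N j) - ∑ i, h i) :
    (Matrix.of fun i j =>
      if 0 ≤ N j - h i then
        Polynomial.C ((M i j).coeff (N j - h i).toNat) * X ^ (N j - h i).toNat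
      else (0 : K[X])).det = 0 := by
  have hzero : ∀ i j, N j - h i < 0 → M i j = 0 := by
    intro i j hneg
    by_contra hM
    have hd := hmaj i j
    rw [degree_eq_natDegree hM] at hd
    have hd' : ((M i j).natDegree : ℤ) ≤ N j - h i := WithBot.coe_le_coe.mp hd
    omega
  have hdeg : ∀ i j, (M i j).natDegree ≤ (N j - h i).toNat := by
    intro i j
    by_cases hM : M i j = 0
    · simp [hM]
    have hd := hmaj i j
    rw [degree_eq_natDegree hM] at hd
    have hd' : ((M i j).natDegree : ℤ) ≤ N j - h i := WithBot.coe_le_coe.mp hd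
    omega
  set D : ℕ := ((∑ j, N j) - ∑ i, h i).toNat with hD
  have hcoeff : M.det.coeff D = 0 := coeff_eq_zero_of_natDegree_lt (by omega)
  suffices hdetA : (Matrix.of fun i j =>
      if 0 ≤ N j - h i then
        Polynomial.C ((M i j).coeff (N j - h i).toNat) * X ^ (N j - h i).toNat
      else (0 : K[X])).det = C (M.det.coeff D) * X ^ D by
    rw [hdetA, hcoeff, C_0, zero_mul]
  rw [Matrix.det_apply, Matrix.det_apply, finsetSum_coeff, map_sum, Finset.sum_mul]
  refine Finset.sum_congr rfl fun σ _ => ?_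
  rw [coeff_smul, Units.smul_def, Units.smul_def, map_zsmul, smul_mul_assoc]
  congr 1
  simp only [Matrix.of_apply]
  by_cases hσ : ∀ i, 0 ≤ N i - h (σ i)
  · have hsum : D = ∑ i, (N i - h (σ i)).toNat := by
      zify
      rw [Finset.sum_congr rfl fun i _ => Int.toNat_of_nonneg (hσ i), Finset.sum_sub_distrib,
        Equiv.sum_comp σ h]
      omega
    rw [hsum, coeff_prod_sum_of_natDegree_le _ _ _ fun i _ => hdeg (σ i) i, map_prod,
      ← Finset.prod_pow_eq_pow_sum, ← Finset.prod_mul_distrib]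
    exact Finset.prod_congr rfl fun i _ => if_pos (hσ i)
  · push Not at hσ
    obtain ⟨i, hi⟩ := hσ
    have hM : ∏ i, M (σ i) i = 0 := Finset.prod_eq_zero (Finset.mem_univ i) (hzero _ _ hi)
    rw [hM, Finset.prod_eq_zero (Finset.mem_univ i) (if_neg hi.not_ge), coeff_zero, C_0, zero_mul]
end

section
/- Let K be a field, n ≥ 1, and let M be an n×n matrix with entries in K[X] such that det M ≠ 0. Let N_1,…,N_n and h_1,…,h_n be integers such that for all i,j: deg(M_{ij}) ≤ N_j − h_i (in particular M_{ij} = 0 whenever N_j − h_i < 0). Define the characteristic matrix Ā with entries in K[λ] by Ā_{ij} = a_{ij} λ^{N_j − h_i}, where a_{ij} is the coefficient of X^{N_j − h_i} in M_{ij} when N_j − h_i ≥ 0, and Ā_{ij} = 0 when N_j − h_i < 0. If ∑_{j=1}^n N_j − ∑_{i=1}^n h_i = deg(det M), then det Ā = ℓ · λ^{deg(det M)}, where ℓ ∈ K is the leading coefficient of det M. -/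
open Polynomial

theorem Polynomial.eq_zero_or_natDegree_le_of_map_degree_le {R : Type*} [Semiring R] {p : R[X]}
    {z : ℤ} (hp : p.degree.map (Nat.cast : ℕ → ℤ) ≤ (z : WithBot ℤ)) :
    p = 0 ∨ (p.natDegree : ℤ) ≤ z := by
  by_cases h0 : p = 0
  · exact Or.inl h0
  · rw [degree_eq_natDegree h0] at hp
    exact Or.inr (WithBot.coe_le_coe.mp hp)

/-- For an optimal majorant `(N, h)` of a polynomial matrix `M` with
`det M ≠ 0` (i.e. `∑ N - ∑ h = deg (det M)`), the determinant of the
characteristic matrix `Ā i j = (coeff of X^(N j - h i) in M i j) · λ^(N j - h i)`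
(taken to be `0` when `N j - h i < 0`) equals `ℓ · λ^(deg det M)`, where `ℓ` is
the leading coefficient of `det M`. -/
theorem det_char_matrix_of_optimal {K : Type*} [Field K]
    (n : ℕ) (hn : 1 ≤ n) (M : Matrix (Fin n) (Fin n) K[X])
    (hdet : M.det ≠ 0) (N h : Fin n → ℤ)
    (hmaj : ∀ i j, ((M i j).degree.map (Nat.cast : ℕ → ℤ)) ≤
      ((N j - h i : ℤ) : WithBot ℤ))
    (hopt : (∑ j, N j) - ∑ i, h i = (M.det.natDegree : ℤ)) :
    (Matrix.of fun i j =>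
      if 0 ≤ N j - h i then
        Polynomial.C ((M i j).coeff (N j - h i).toNat) * X ^ (N j - h i).toNat
      else (0 : K[X])).det =
      Polynomial.C (M.det.leadingCoeff) * X ^ M.det.natDegree := by
  have hlead : M.det.leadingCoeff = ∑ σ : Equiv.Perm (Fin n),
      (Equiv.Perm.sign σ • ∏ i, M (σ i) i).coeff M.det.natDegree := by
    rw [← finsetSum_coeff, ← Matrix.det_apply, leadingCoeff]
  rw [hlead, Matrix.det_apply, map_sum, Finset.sum_mul]
  refine Finset.sum_congr rfl fun σ _ => ?_
  rw [coeff_smul, Units.smul_def, Units.smul_def, map_zsmul, smul_mul_assoc]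
  congr 1
  simp only [Matrix.of_apply]
  by_cases hσ : ∀ i, 0 ≤ N i - h (σ i)
  · have hD : ∑ i, (N i - h (σ i)).toNat = M.det.natDegree := by
      zify
      simp only [Int.toNat_of_nonneg (hσ _), Finset.sum_sub_distrib, Equiv.sum_comp σ h, hopt]
    have hdeg : ∀ i ∈ Finset.univ, (M (σ i) i).natDegree ≤ (N i - h (σ i)).toNat := by
      intro i _
      rcases eq_zero_or_natDegree_le_of_map_degree_le (hmaj (σ i) i) with h0 | hle
      · simp [h0]
      · omega
    simp only [hσ, if_true, Finset.prod_mul_distrib, Finset.prod_pow_eq_pow_sum]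
    rw [← map_prod, ← coeff_prod_sum_of_natDegree_le _ _ _ hdeg, hD]
  · push Not at hσ
    obtain ⟨i, hi⟩ := hσ
    have h0 : M (σ i) i = 0 :=
      (eq_zero_or_natDegree_le_of_map_degree_le (hmaj (σ i) i)).resolve_right (by omega)
    rw [Finset.prod_eq_zero (Finset.mem_univ i) (if_neg (by omega)),
      Finset.prod_eq_zero (f := fun i => M (σ i) i) (Finset.mem_univ i) h0]
    simp
end
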